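/- arXiv:2406.11222 — 2 statements merged into one kernel-verified Lean document; each statement's English description precedes it below -/
import Mathlib

section
/- Let R be a valuation domain whose unique maximal ideal P is principal, say P = Rp. Then a finitely presented R-module M is strongly virtually regular if and only if M ≅ R^n ⊕ (R/Rp)^m for some nonnegative integers n and m. -/
/-- A submodule is a direct summand if it has a complement. -/
def Submodule.IsDirectSummand {R M : Type*} [Ring R] [AddCommGroup M] [Module R M]
    (N : Submodule R M) : Prop :=
  ∃ N' : Submodule R M, IsCompl N N'

/-- A module is strongly virtually regular if every finitely generated submodule is
isomorphic to a direct summand. -/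
def StronglyVirtuallyRegular (R M : Type*) [Ring R] [AddCommGroup M] [Module R M] : Prop :=
  ∀ A : Submodule R M, A.FG → ∃ N : Submodule R M, N.IsDirectSummand ∧
    Nonempty (A ≃ₗ[R] N)

theorem StronglyVirtuallyRegular.exists_isDirectSummand_of_leftInverse {R M A : Type*} [Ring R]
    [AddCommGroup M] [Module R M] [AddCommGroup A] [Module R A] (i : A →ₗ[R] M) (r : M →ₗ[R] A)
    (h : ∀ x, r (i x) = x) :
    ∃ N : Submodule R M, N.IsDirectSummand ∧ Nonempty (A ≃ₗ[R] N) := by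
  refine ⟨LinearMap.range i, ⟨LinearMap.ker (i.rangeRestrict ∘ₗ r),
    LinearMap.isCompl_of_proj ?_⟩, ⟨LinearEquiv.ofInjective i (Function.LeftInverse.injective h)⟩⟩
  rintro ⟨_, x, rfl⟩
  ext
  simp [h]

theorem exists_leftInverse_fin_fun {R W : Type*} [Ring R] [AddCommGroup W] [Module R W] {k n : ℕ}
    (h : k ≤ n) : ∃ (i : (Fin k → W) →ₗ[R] (Fin n → W)) (r : (Fin n → W) →ₗ[R] (Fin k → W)),
      ∀ x, r (i x) = x := by
  refine ⟨LinearMap.pi fun j ↦ if hj : j.1 < k then LinearMap.proj ⟨j, hj⟩ else 0,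
    LinearMap.funLeft R W (Fin.castLE h), fun x ↦ ?_⟩
  ext j
  simp [LinearMap.funLeft_apply]

theorem ValuationRing.free_of_isTorsionFree {R M : Type*} [CommRing R] [IsDomain R]
    [ValuationRing R] [AddCommGroup M] [Module R M] [Module.Finite R M]
    [Module.IsTorsionFree R M] : Module.Free R M := by
  have : Module.Flat R M := by
    rw [Module.Flat.flat_iff_torsion_eq_bot_of_isBezout]
    exact Submodule.isTorsionFree_iff_torsion_eq_bot.1 inferInstance
  exact Module.free_of_flat_of_isLocalRing

/-- A module embedding into a finite power of `R ⧸ I`, for `I` maximal, is itself such a power. -/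
theorem Ideal.IsMaximal.exists_equiv_fin_fun_quotient {R C : Type*} [CommRing R] {I : Ideal R}
    (hI : I.IsMaximal) [AddCommGroup C] [Module R C] {m : ℕ} (h : C →ₗ[R] (Fin m → R ⧸ I))
    (hh : Function.Injective h) : ∃ j ≤ m, Nonempty (C ≃ₗ[R] (Fin j → R ⧸ I)) := by
  let := Ideal.Quotient.field I
  let W : Submodule (R ⧸ I) (Fin m → R ⧸ I) :=
    { LinearMap.range h with
      smul_mem' := by
        intro c x hx
        obtain ⟨c, rfl⟩ := Ideal.Quotient.mk_surjective c
        exact (LinearMap.range h).smul_mem c hx }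
  refine ⟨Module.finrank (R ⧸ I) W, by simpa using W.finrank_le, ⟨?_⟩⟩
  let e : LinearMap.range h ≃ₗ[R] W :=
    { toFun := fun x ↦ ⟨x.1, x.2⟩
      invFun := fun x ↦ ⟨x.1, x.2⟩
      map_add' := fun _ _ ↦ rfl
      map_smul' := fun _ _ ↦ rfl }
  exact LinearEquiv.ofInjective h hh ≪≫ₗ e ≪≫ₗ
    (Module.finBasis (R ⧸ I) W).equivFun.restrictScalars R

theorem stronglyVirtuallyRegular_of_equiv {R M : Type*} [CommRing R] [IsDomain R] [ValuationRing R]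
    {I : Ideal R} (hI : I.IsMaximal) [AddCommGroup M] [Module R M] {n m : ℕ}
    (e : M ≃ₗ[R] ((Fin n → R) × (Fin m → R ⧸ I))) : StronglyVirtuallyRegular R M := by
  intro A hA
  have : Module.Finite R A := Module.Finite.iff_fg.2 hA
  let f : A →ₗ[R] ((Fin n → R) × (Fin m → R ⧸ I)) := e.toLinearMap ∘ₗ A.subtype
  have hf : Function.Injective f := e.injective.comp A.injective_subtype
  let g : A →ₗ[R] (Fin n → R) := LinearMap.fst R _ _ ∘ₗ f
  have : Module.Free R (LinearMap.range g) := ValuationRing.free_of_isTorsionFree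
  obtain ⟨s, hs⟩ := g.rangeRestrict.exists_rightInverse_of_surjective g.range_rangeRestrict
  obtain ⟨j, hj, ⟨eC⟩⟩ := hI.exists_equiv_fin_fun_quotient
    (LinearMap.snd R _ _ ∘ₗ f ∘ₗ (LinearMap.ker g).subtype) (by
      rw [injective_iff_map_eq_zero]
      rintro ⟨x, hx⟩ h
      have : f x = 0 := Prod.ext hx h
      simpa using (map_eq_zero_iff f hf).1 this)
  let eA : (LinearMap.ker g × LinearMap.range g) ≃ₗ[R] A :=
    lequivProdOfRightSplitExact (j := (LinearMap.ker g).subtype) (g := g.rangeRestrict)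
      (LinearMap.ker g).injective_subtype (by simp) hs
  have hk : Module.finrank R (LinearMap.range g) ≤ n := by
    simpa using (LinearMap.range g).finrank_le
  let eB := (Module.finBasis R (LinearMap.range g)).equivFun
  obtain ⟨i₁, r₁, h₁⟩ := exists_leftInverse_fin_fun (R := R) (W := R) hk
  obtain ⟨i₂, r₂, h₂⟩ := exists_leftInverse_fin_fun (R := R) (W := R ⧸ I) hj
  let E := eA.symm ≪≫ₗ (eC.prodCongr eB) ≪≫ₗ LinearEquiv.prodComm R _ _
  refine StronglyVirtuallyRegular.exists_isDirectSummand_of_leftInverse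
    (e.symm.toLinearMap ∘ₗ i₁.prodMap i₂ ∘ₗ E.toLinearMap)
    (E.symm.toLinearMap ∘ₗ r₁.prodMap r₂ ∘ₗ e.toLinearMap) fun x ↦ ?_
  simp only [LinearMap.comp_apply, LinearEquiv.coe_coe, LinearEquiv.apply_symm_apply,
    LinearMap.prodMap_apply, h₁, h₂, Prod.mk.eta, LinearEquiv.symm_apply_apply]

section ResidueField

open TensorProduct IsLocalRing

theorem IsLocalRing.finrank_residueField_tensor_prod (R X Y : Type*) [CommRing R] [IsLocalRing R]
    [AddCommGroup X] [Module R X] [Module.Finite R X]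
    [AddCommGroup Y] [Module R Y] [Module.Finite R Y] :
    Module.finrank (ResidueField R) (ResidueField R ⊗[R] (X × Y)) =
      Module.finrank (ResidueField R) (ResidueField R ⊗[R] X) +
        Module.finrank (ResidueField R) (ResidueField R ⊗[R] Y) := by
  rw [(TensorProduct.prodRight R (ResidueField R) (ResidueField R) X Y).finrank_eq,
    Module.finrank_prod]

theorem IsLocalRing.finrank_residueField_tensor_fin_fun_quotient {R : Type*} [CommRing R]
    [IsLocalRing R] {I : Ideal R} (hI : I ≤ maximalIdeal R) (r : ℕ) :
    Module.finrank (ResidueField R) (ResidueField R ⊗[R] (Fin r → R ⧸ I)) = r := by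
  have h1 : Module.finrank (ResidueField R) (ResidueField R ⊗[R] (R ⧸ I)) = 1 := by
    have : Nontrivial (R ⧸ I) := Ideal.Quotient.nontrivial_iff.2
      (ne_top_of_le_ne_top (Ideal.IsPrime.ne_top inferInstance) hI)
    have : Nontrivial (ResidueField R ⊗[R] (R ⧸ I)) := by
      rw [← not_subsingleton_iff_nontrivial, subsingleton_tensorProduct,
        not_subsingleton_iff_nontrivial]
      infer_instance
    refine le_antisymm (finrank_le_one (1 ⊗ₜ 1) fun w ↦ ?_) Module.finrank_pos
    obtain ⟨y, rfl⟩ := TensorProduct.mk_surjective R (R ⧸ I) (ResidueField R)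
      residue_surjective w
    obtain ⟨y, rfl⟩ := Ideal.Quotient.mk_surjective y
    refine ⟨residue R y, ?_⟩
    rw [TensorProduct.smul_tmul', TensorProduct.mk_apply, smul_eq_mul, mul_one,
      ← mul_one (Ideal.Quotient.mk I y), ← smul_eq_mul, ← Ideal.Quotient.algebraMap_eq,
      smul_eq_mul, ← Algebra.smul_def, ← TensorProduct.smul_tmul, Algebra.smul_def, mul_one]
    rfl
  rw [(TensorProduct.piRight R (ResidueField R) (ResidueField R)
    (fun _ : Fin r ↦ R ⧸ I)).finrank_eq, Module.finrank_pi_fintype]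
  simp [h1]

/-- A minimal generating family of a finite module over a local ring: as many elements as the
dimension of the fibre, with all relations having coefficients in the maximal ideal. -/
theorem IsLocalRing.exists_minimal_generators (R X : Type*) [CommRing R] [IsLocalRing R]
    [AddCommGroup X] [Module R X] [Module.Finite R X] :
    ∃ (d : ℕ) (_ : d = Module.finrank (ResidueField R) (ResidueField R ⊗[R] X)) (f : Fin d → X),
      Submodule.span R (Set.range f) = ⊤ ∧
        ∀ x, Fintype.linearCombination R f x = 0 → ∀ i, x i ∈ maximalIdeal R := by
  let b := Module.finBasis (ResidueField R) (ResidueField R ⊗[R] X)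
  choose f hf using fun i ↦ TensorProduct.mk_surjective R X (ResidueField R) residue_surjective (b i)
  refine ⟨_, rfl, f, span_eq_top_of_tmul_eq_basis f b hf, fun x hx i ↦ ?_⟩
  have h := congrArg (TensorProduct.mk R (ResidueField R) X 1) hx
  rw [Fintype.linearCombination_apply, map_sum, map_zero] at h
  simp only [map_smul, hf] at h
  have h' : ∑ i, residue R (x i) • b i = 0 := by
    rw [← h]
    exact Finset.sum_congr rfl fun i _ ↦ algebraMap_smul (ResidueField R) (x i) (b i)
  rw [← residue_eq_zero_iff]
  exact Fintype.linearIndependent_iff.1 b.linearIndependent _ h' i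

end ResidueField

theorem finrank_fin_fun_quotient_span_singleton {R : Type*} [CommRing R] [IsDomain R] {p : R}
    (hp : p ≠ 0) (r : ℕ) : Module.finrank R (Fin r → R ⧸ Ideal.span {p}) = 0 := by
  rw [Module.finrank_eq_zero_iff]
  refine fun x ↦ ⟨p, hp, funext fun i ↦ ?_⟩
  obtain ⟨y, hy⟩ := Ideal.Quotient.mk_surjective (x i)
  rw [Pi.smul_apply, ← hy, Algebra.smul_def, Ideal.Quotient.algebraMap_eq, ← map_mul,
    Pi.zero_apply, Ideal.Quotient.eq_zero_iff_mem]
  exact Ideal.mul_mem_right _ _ (Ideal.mem_span_singleton_self p)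

/-- If `φ` is a map from a free module whose kernel has a basis consisting of multiples `p • c i`,
then the images of the `c i` span a copy of a power of `R ⧸ (p)`. -/
theorem nonempty_fin_fun_quotient_equiv_range {R F M : Type*} [CommRing R] [AddCommGroup F]
    [Module R F] [AddCommGroup M] [Module R M] (φ : F →ₗ[R] M) {p : R} {r : ℕ}
    (b : Module.Basis (Fin r) R (LinearMap.ker φ)) (c : Fin r → F)
    (hc : ∀ i, (b i : F) = p • c i) :
    Nonempty ((Fin r → R ⧸ Ideal.span {p}) ≃ₗ[R]
      LinearMap.range (Fintype.linearCombination R (φ ∘ c))) := by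
  set ψ := Fintype.linearCombination R (φ ∘ c) with hψ
  have hψ_apply (x : Fin r → R) : ψ x = φ (∑ i, x i • c i) := by
    simp [hψ, Fintype.linearCombination_apply]
  let q : (Fin r → R) →ₗ[R] (Fin r → R ⧸ Ideal.span {p}) := (Submodule.mkQ _).compLeft (Fin r)
  have hq : Function.Surjective q := (Submodule.mkQ_surjective _).comp_left
  have hq_ker (x : Fin r → R) : x ∈ LinearMap.ker q ↔ ∀ i, p ∣ x i := by
    simp only [LinearMap.mem_ker, funext_iff, ← Ideal.mem_span_singleton]
    exact forall_congr' fun i ↦ Submodule.Quotient.mk_eq_zero _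
  have hker : LinearMap.ker q = LinearMap.ker ψ := by
    ext x
    rw [hq_ker, LinearMap.mem_ker, hψ_apply]
    constructor
    · intro h
      choose z hz using h
      rw [map_sum]
      refine Finset.sum_eq_zero fun i _ ↦ ?_
      rw [hz, mul_comm, mul_smul, ← hc, map_smul, LinearMap.mem_ker.1 (b i).2, smul_zero]
    · intro h i
      let y : LinearMap.ker φ := ⟨_, h⟩
      have hy : ∑ i, x i • b i = p • y := by
        ext
        simp [y, hc, Finset.smul_sum, smul_comm p]
      refine ⟨b.repr y i, ?_⟩
      rw [← smul_eq_mul, ← Finsupp.smul_apply, ← map_smul, ← hy, b.repr_sum_self]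
  exact ⟨(q.quotKerEquivOfSurjective hq).symm ≪≫ₗ Submodule.quotEquivOfEq _ _ hker ≪≫ₗ
    ψ.quotKerEquivRange⟩

theorem StronglyVirtuallyRegular.exists_equiv {R M : Type*} [CommRing R] [IsDomain R]
    [ValuationRing R] {p : R} (hp : IsLocalRing.maximalIdeal R = Ideal.span {p})
    [AddCommGroup M] [Module R M] [Module.FinitePresentation R M]
    (hM : StronglyVirtuallyRegular R M) :
    ∃ n m : ℕ, Nonempty (M ≃ₗ[R] ((Fin n → R) × (Fin m → R ⧸ Ideal.span {p}))) := by
  obtain ⟨d, hd, f, hf, hmin⟩ := IsLocalRing.exists_minimal_generators R M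
  set φ := Fintype.linearCombination R f
  have hφ : Function.Surjective φ := by
    rw [← LinearMap.range_eq_top, Fintype.range_linearCombination, hf]
  have hdvd (x : LinearMap.ker φ) (i : Fin d) : p ∣ x.1 i := by
    rw [← Ideal.mem_span_singleton, ← hp]
    exact hmin x.1 x.2 i
  obtain rfl | hp0 := eq_or_ne p 0
  · have hinj : Function.Injective φ := by
      rw [injective_iff_map_eq_zero]
      exact fun x hx ↦ funext fun i ↦ zero_dvd_iff.1 (hdvd ⟨x, hx⟩ i)
    exact ⟨d, 0, ⟨(LinearEquiv.ofBijective φ ⟨hinj, hφ⟩).symm ≪≫ₗ LinearEquiv.prodUnique.symm⟩⟩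
  have : Module.Finite R (LinearMap.ker φ) :=
    Module.Finite.iff_fg.2 (Module.FinitePresentation.fg_ker φ hφ)
  have : Module.Free R (LinearMap.ker φ) := ValuationRing.free_of_isTorsionFree
  let b := Module.finBasis R (LinearMap.ker φ)
  set r := Module.finrank R (LinearMap.ker φ) with hr
  choose c hc using fun i ↦ hdvd (b i)
  obtain ⟨e⟩ := nonempty_fin_fun_quotient_equiv_range φ b c fun i ↦ funext (hc i)
  obtain ⟨N, ⟨N', hN⟩, ⟨e'⟩⟩ := hM _ (Module.Finite.iff_fg.1 (Module.Finite.range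
    (Fintype.linearCombination R (φ ∘ c))))
  have : Module.Finite R N' := Module.Finite.of_surjective (N'.projectionOnto N hN.symm)
    (Submodule.projectionOnto_surjective hN.symm)
  let E : M ≃ₗ[R] ((Fin r → R ⧸ Ideal.span {p}) × N') :=
    (N.prodEquivOfIsCompl N' hN).symm ≪≫ₗ ((e ≪≫ₗ e').symm.prodCongr (LinearEquiv.refl R N'))
  have h_rank : Module.finrank R M + r = d := by
    rw [← (φ.quotKerEquivOfSurjective hφ).finrank_eq, hr,
      (LinearMap.ker φ).finrank_quotient_add_finrank, Module.finrank_fin_fun]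
  have h_rank' : Module.finrank R M = Module.finrank R N' := by
    have h := (LinearMap.ker (LinearMap.snd R (Fin r → R ⧸ Ideal.span {p})
      N')).finrank_quotient_add_finrank
    rw [((LinearMap.snd R (Fin r → R ⧸ Ideal.span {p}) N').quotKerEquivOfSurjective
      LinearMap.snd_surjective).finrank_eq, LinearMap.ker_snd,
      ← (LinearEquiv.ofInjective _ LinearMap.inl_injective).finrank_eq,
      finrank_fin_fun_quotient_span_singleton hp0, add_zero] at h
    rw [E.finrank_eq, h]
  have h_fibre := hd.trans (E.baseChange R (IsLocalRing.ResidueField R)).finrank_eq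
  rw [IsLocalRing.finrank_residueField_tensor_prod,
    IsLocalRing.finrank_residueField_tensor_fin_fun_quotient hp.ge] at h_fibre
  obtain ⟨d', hd', g, hg, -⟩ := IsLocalRing.exists_minimal_generators R N'
  let B := basisOfTopLeSpanOfCardEqFinrank g hg.ge (by rw [Fintype.card_fin]; omega)
  exact ⟨_, r, ⟨E ≪≫ₗ LinearEquiv.prodComm R _ _ ≪≫ₗ
    B.equivFun.prodCongr (LinearEquiv.refl R _)⟩⟩

/-- Let `R` be a valuation domain whose maximal ideal is principal, generated by `p`.
A finitely presented `R`-module `M` is strongly virtually regular iff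
`M ≅ R^n ⊕ (R/Rp)^m`. -/
theorem fp_stronglyVirtuallyRegular_iff_of_maximalIdeal_principal
    (R : Type*) [CommRing R] [IsDomain R] [ValuationRing R]
    (p : R) (hp : IsLocalRing.maximalIdeal R = Ideal.span {p})
    (M : Type*) [AddCommGroup M] [Module R M] (hfp : Module.FinitePresentation R M) :
    StronglyVirtuallyRegular R M ↔
      ∃ n m : ℕ,
        Nonempty (M ≃ₗ[R] ((Fin n → R) × (Fin m → R ⧸ Ideal.span {p}))) := by
  have hmax : (Ideal.span {p}).IsMaximal := hp ▸ IsLocalRing.maximalIdeal.isMaximal R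
  exact ⟨fun h ↦ h.exists_equiv hp, fun ⟨_, _, ⟨e⟩⟩ ↦ stronglyVirtuallyRegular_of_equiv hmax e⟩
end

section
/- Let M be a finitely generated abelian group (ℤ-module). The following are equivalent: (1) M is virtually semisimple; (2) M is strongly virtually regular; (3) M is completely virtually regular; (4) the torsion subgroup T(M) is semisimple as a ℤ-module. -/
/-- A module is virtually regular if every cyclic submodule is isomorphic to a
direct summand. -/
def VirtuallyRegular (R M : Type*) [Ring R] [AddCommGroup M] [Module R M] : Prop :=
  ∀ m : M, ∃ N : Submodule R M, N.IsDirectSummand ∧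
    Nonempty ((Submodule.span R {m}) ≃ₗ[R] N)

/-- A module is completely virtually regular if every submodule is virtually regular. -/
def CompletelyVirtuallyRegular (R M : Type*) [Ring R] [AddCommGroup M] [Module R M] : Prop :=
  ∀ A : Submodule R M, VirtuallyRegular R A

/-- A module is virtually semisimple if every submodule is isomorphic to a direct
summand. -/
def VirtuallySemisimple (R M : Type*) [Ring R] [AddCommGroup M] [Module R M] : Prop :=
  ∀ A : Submodule R M, ∃ N : Submodule R M, N.IsDirectSummand ∧
    Nonempty (A ≃ₗ[R] N)

section DirectSummand

variable {R M N : Type*} [Ring R] [AddCommGroup M] [Module R M] [AddCommGroup N] [Module R N]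

/-- A module that is a retract of `M` is isomorphic to a direct summand of `M`. -/
theorem Submodule.IsDirectSummand.exists_linearEquiv_of_comp_eq_id {i : N →ₗ[R] M} {r : M →ₗ[R] N}
    (h : r ∘ₗ i = LinearMap.id) :
    ∃ P : Submodule R M, P.IsDirectSummand ∧ Nonempty (N ≃ₗ[R] P) := by
  have hri (x : N) : r (i x) = x := LinearMap.congr_fun h x
  have hi : Function.Injective i := Function.LeftInverse.injective hri
  refine ⟨LinearMap.range i, ⟨LinearMap.ker (i.rangeRestrict ∘ₗ r), LinearMap.isCompl_of_proj ?_⟩,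
    ⟨LinearEquiv.ofInjective i hi⟩⟩
  rintro ⟨_, x, rfl⟩
  exact Subtype.ext (congrArg i (hri x))

theorem VirtuallySemisimple.virtuallyRegular (h : VirtuallySemisimple R M) :
    VirtuallyRegular R M :=
  fun m => h (Submodule.span R {m})

theorem VirtuallySemisimple.stronglyVirtuallyRegular (h : VirtuallySemisimple R M) :
    StronglyVirtuallyRegular R M :=
  fun A _ => h A

theorem StronglyVirtuallyRegular.virtuallySemisimple [IsNoetherian R M]
    (h : StronglyVirtuallyRegular R M) : VirtuallySemisimple R M :=
  fun A => h A (IsNoetherian.noetherian A)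

end DirectSummand

section Semisimple

variable {R M : Type*} [Ring R] [AddCommGroup M] [Module R M]

theorem isSemisimpleModule_sSup_isSemisimpleModule :
    IsSemisimpleModule R (sSup {N : Submodule R M | IsSemisimpleModule R N} : Submodule R M) := by
  rw [sSup_eq_iSup]
  exact isSemisimpleModule_biSup_of_isSemisimpleModule_submodule fun _ hN => hN

/-- In a virtually semisimple Noetherian module the largest semisimple submodule is a direct
summand. -/
theorem VirtuallySemisimple.isDirectSummand_sSup_isSemisimpleModule [IsNoetherian R M]
    (h : VirtuallySemisimple R M) :
    (sSup {N : Submodule R M | IsSemisimpleModule R N}).IsDirectSummand := by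
  set S := sSup {N : Submodule R M | IsSemisimpleModule R N}
  have hSS : IsSemisimpleModule R S := isSemisimpleModule_sSup_isSemisimpleModule
  obtain ⟨N, hN, ⟨e⟩⟩ := h S
  have hNS : N ≤ S := le_sSup (IsSemisimpleModule.congr e.symm)
  let f : S →ₗ[R] S := Submodule.inclusion hNS ∘ₗ e.toLinearMap
  have hf : Function.Surjective f := IsArtinian.surjective_of_injective_endomorphism f
    ((Submodule.inclusion_injective hNS).comp e.injective)
  have hSN : S ≤ N := fun x hx => by
    obtain ⟨y, hy⟩ := hf ⟨x, hx⟩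
    have hxy : ((e y : N) : M) = x := congrArg Subtype.val hy
    exact hxy ▸ (e y).2
  rwa [← le_antisymm hNS hSN]

end Semisimple

section Torsion

variable {R M : Type*} [CommRing R] [AddCommGroup M] [Module R M]

theorem Submodule.coe_mem_torsion_iff (A : Submodule R M) {x : A} :
    (x : M) ∈ torsion R M ↔ x ∈ torsion R A := by
  simp only [mem_torsion_iff, Subtype.ext_iff]
  rfl

/-- The inclusion of the torsion of a submodule in the torsion of the ambient module. -/
def Submodule.torsionInclusion (A : Submodule R M) : torsion R A →ₗ[R] torsion R M :=
  A.subtype.restrict fun _ => A.coe_mem_torsion_iff.2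

theorem Submodule.torsionInclusion_injective (A : Submodule R M) :
    Function.Injective A.torsionInclusion := fun _ _ hxy =>
  Subtype.ext (Subtype.ext (congrArg (fun z : torsion R M => (z : M)) hxy))

end Torsion

section PrincipalIdealRing

variable {R M : Type*} [CommRing R] [IsPrincipalIdealRing R] [AddCommGroup M] [Module R M]

theorem Submodule.isPrincipal_of_span_singleton_eq_top {x : M} (hx : span R {x} = ⊤)
    (A : Submodule R M) : A.IsPrincipal := by
  have hsurj : Function.Surjective (LinearMap.toSpanSingleton R M x) := by
    rw [← LinearMap.range_eq_top, LinearMap.range_toSpanSingleton, hx]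
  rw [← map_comap_eq_of_surjective hsurj A]
  exact (IsPrincipalIdealRing.principal _).map _

/-- A cyclic virtually regular module over a principal ideal ring is virtually semisimple. -/
theorem VirtuallyRegular.virtuallySemisimple_of_span_eq_top (h : VirtuallyRegular R M) {x : M}
    (hx : Submodule.span R {x} = ⊤) : VirtuallySemisimple R M := fun A => by
  obtain ⟨m, rfl⟩ := Submodule.isPrincipal_of_span_singleton_eq_top hx A
  exact h m

end PrincipalIdealRing

theorem exists_comp_eq_id_of_finrank_le {R F F' : Type*} [CommRing R] [StrongRankCondition R]
    [AddCommGroup F] [Module R F]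
    [AddCommGroup F'] [Module R F'] [Module.Free R F] [Module.Finite R F]
    [Module.Free R F'] [Module.Finite R F'] (h : Module.finrank R F ≤ Module.finrank R F') :
    ∃ (i : F →ₗ[R] F') (r : F' →ₗ[R] F), r ∘ₗ i = LinearMap.id := by
  let r : F' →ₗ[R] F := (Module.finBasis R F).equivFun.symm.toLinearMap ∘ₗ
    LinearMap.funLeft R R (Fin.castLE h) ∘ₗ (Module.finBasis R F').equivFun.toLinearMap
  have hr : Function.Surjective r := (Module.finBasis R F).equivFun.symm.surjective.comp
    ((LinearMap.funLeft_surjective_of_injective R R _ (Fin.castLE_injective h)).comp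
      (Module.finBasis R F').equivFun.surjective)
  obtain ⟨i, hi⟩ := Module.projective_lifting_property r LinearMap.id hr
  exact ⟨i, r, hi⟩

section PrincipalIdealDomain

variable {R M : Type*} [CommRing R] [IsDomain R] [IsPrincipalIdealRing R]
  [AddCommGroup M] [Module R M]

/-- A finitely generated module over a principal ideal domain splits as the product of its torsion
submodule and the torsion-free quotient. -/
theorem Submodule.nonempty_torsion_prod_quotient_linearEquiv [Module.Finite R M] :
    Nonempty ((torsion R M × (M ⧸ torsion R M)) ≃ₗ[R] M) := by
  obtain ⟨f, hf⟩ :=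
    Module.projective_lifting_property _ LinearMap.id (torsion R M).mkQ_surjective
  exact ⟨lequivProdOfRightSplitExact (torsion R M).injective_subtype
    (by rw [range_subtype, ker_mkQ]) hf⟩

theorem VirtuallySemisimple.of_isSemisimpleModule_torsion [Module.Finite R M]
    [IsSemisimpleModule R (Submodule.torsion R M)] : VirtuallySemisimple R M := fun A => by
  let t := A.torsionInclusion
  obtain ⟨r, hr⟩ :=
    IsSemisimpleModule.extension_property t A.torsionInclusion_injective LinearMap.id
  have hle : Submodule.torsion R A ≤ (Submodule.torsion R M).comap A.subtype :=
    fun _ => A.coe_mem_torsion_iff.2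
  have hq : Function.Injective (Submodule.mapQ _ _ A.subtype hle) := by
    rw [← LinearMap.ker_eq_bot, Submodule.ker_mapQ,
      show (Submodule.torsion R M).comap A.subtype = Submodule.torsion R A from
        Submodule.ext fun _ => A.coe_mem_torsion_iff, Submodule.mkQ_map_self]
  obtain ⟨j, s, hs⟩ :=
    exists_comp_eq_id_of_finrank_le (LinearMap.finrank_le_finrank_of_injective hq)
  obtain ⟨eA⟩ := Submodule.nonempty_torsion_prod_quotient_linearEquiv (R := R) (M := A)
  obtain ⟨eM⟩ := Submodule.nonempty_torsion_prod_quotient_linearEquiv (R := R) (M := M)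
  apply Submodule.IsDirectSummand.exists_linearEquiv_of_comp_eq_id
    (i := eM.toLinearMap ∘ₗ t.prodMap j ∘ₗ eA.symm.toLinearMap)
    (r := eA.toLinearMap ∘ₗ r.prodMap s ∘ₗ eM.symm.toLinearMap)
  ext x : 1
  have hr' (y) : r (t y) = y := LinearMap.congr_fun hr y
  have hs' (y) : s (j y) = y := LinearMap.congr_fun hs y
  simp [hr', hs']

theorem CompletelyVirtuallyRegular.of_isSemisimpleModule_torsion [Module.Finite R M]
    [IsSemisimpleModule R (Submodule.torsion R M)] : CompletelyVirtuallyRegular R M := fun A => by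
  have : IsSemisimpleModule R (Submodule.torsion R A) :=
    .of_injective A.torsionInclusion A.torsionInclusion_injective
  exact VirtuallySemisimple.of_isSemisimpleModule_torsion.virtuallyRegular

theorem Submodule.exists_isAtom_le_span_singleton_of_mem_torsion {x : M}
    (hx : x ∈ torsion R M) (hx0 : x ≠ 0) : ∃ S : Submodule R M, IsAtom S ∧ S ≤ span R {x} := by
  obtain ⟨a, ha⟩ := (mem_torsion_iff x).1 hx
  have hlen : IsFiniteLength R (R ⧸ Ideal.span {(a : R)}) :=
    isFiniteLength_quotient_span_singleton R a.2
  have := (isFiniteLength_iff_isNoetherian_isArtinian.1 hlen).2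
  let f : (R ⧸ Ideal.span {(a : R)}) →ₗ[R] M :=
    liftQSpanSingleton (a : R) (LinearMap.toSpanSingleton R M x) ha
  have hf : LinearMap.range f = span R {x} := by
    rw [← LinearMap.range_toSpanSingleton]
    exact range_liftQ _ _ _
  have : IsArtinian R (span R {x}) := hf ▸ isArtinian_range f
  have : Nontrivial (span R {x}) := nontrivial_iff_ne_bot.2 (by simpa using hx0)
  obtain ⟨S, hS⟩ := IsAtomic.exists_atom (Submodule R (span R {x}))
  rw [← isSimpleModule_iff_isAtom] at hS
  refine ⟨S.map (span R {x}).subtype, ?_, map_subtype_le _ _⟩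
  rw [← isSimpleModule_iff_isAtom]
  exact IsSimpleModule.congr (Submodule.equivSubtypeMap _ S).symm

theorem VirtuallySemisimple.isSemisimpleModule_torsion [IsNoetherian R M]
    (h : VirtuallySemisimple R M) : IsSemisimpleModule R (Submodule.torsion R M) := by
  obtain ⟨N, hN⟩ := h.isDirectSummand_sSup_isSemisimpleModule
  set S := sSup {N : Submodule R M | IsSemisimpleModule R N}
  have hSS : IsSemisimpleModule R S := isSemisimpleModule_sSup_isSemisimpleModule
  suffices hle : Submodule.torsion R M ≤ S from
    .of_injective _ (Submodule.inclusion_injective hle)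
  intro x hx
  obtain ⟨s, hs, y, hy, rfl⟩ := Submodule.mem_sup.1 (hN.sup_eq_top ▸ Submodule.mem_top (x := x))
  have hyt : y ∈ Submodule.torsion R M := by
    obtain ⟨a, ha⟩ := (Submodule.mem_torsion_iff _).1 hx
    refine (Submodule.mem_torsion_iff _).2 ⟨a, ?_⟩
    have hay : a • y = -(a • s) := by rwa [smul_add, add_comm, add_eq_zero_iff_eq_neg] at ha
    refine Submodule.disjoint_def.1 hN.disjoint _ ?_ (N.smul_mem (a : R) hy)
    exact hay ▸ S.neg_mem (S.smul_mem (a : R) hs)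
  by_cases hy0 : y = 0
  · simpa [hy0] using hs
  obtain ⟨P, hP, hPy⟩ := Submodule.exists_isAtom_le_span_singleton_of_mem_torsion hyt hy0
  have : IsSimpleModule R P := isSimpleModule_iff_isAtom.2 hP
  have hPS : P ≤ S := le_sSup (inferInstance : IsSemisimpleModule R P)
  have hPN : P ≤ N := hPy.trans ((Submodule.span_singleton_le_iff_mem _ _).2 hy)
  exact (hP.1 (le_bot_iff.1 (hN.disjoint hPS hPN))).elim

theorem CompletelyVirtuallyRegular.isSemisimpleModule_torsion
    (h : CompletelyVirtuallyRegular R M) : IsSemisimpleModule R (Submodule.torsion R M) := by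
  have hcyc (x : M) (hx : x ∈ Submodule.torsion R M) :
      IsSemisimpleModule R (Submodule.span R {x}) := by
    have hv : VirtuallySemisimple R (Submodule.span R {x}) :=
      (h _).virtuallySemisimple_of_span_eq_top
        (x := ⟨x, Submodule.mem_span_singleton_self x⟩) (by
          rw [eq_top_iff]
          rintro ⟨y, hy⟩ -
          obtain ⟨b, rfl⟩ := Submodule.mem_span_singleton.1 hy
          exact Submodule.mem_span_singleton.2 ⟨b, rfl⟩)
    have hss := hv.isSemisimpleModule_torsion
    obtain ⟨a, ha⟩ := (Submodule.mem_torsion_iff x).1 hx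
    have htop : Submodule.torsion R (Submodule.span R {x}) = ⊤ := by
      rw [eq_top_iff]
      rintro ⟨y, hy⟩ -
      obtain ⟨b, rfl⟩ := Submodule.mem_span_singleton.1 hy
      exact (Submodule.mem_torsion_iff _).2
        ⟨a, Subtype.ext (show (a : R) • b • x = 0 by
          rw [smul_comm, show (a : R) • x = 0 from ha, smul_zero])⟩
    rw [htop] at hss
    exact IsSemisimpleModule.congr Submodule.topEquiv.symm
  have hsup := isSemisimpleModule_biSup_of_isSemisimpleModule_submodule hcyc
  have hle : Submodule.torsion R M ≤
      ⨆ x ∈ (Submodule.torsion R M : Set M), Submodule.span R {x} := fun x hx =>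
    le_biSup (fun x : M => Submodule.span R {x}) hx (Submodule.mem_span_singleton_self x)
  exact .of_injective _ (Submodule.inclusion_injective hle)

end PrincipalIdealDomain

/-- For a finitely generated abelian group `M`, the following are equivalent:
(1) `M` is virtually semisimple; (2) `M` is strongly virtually regular;
(3) `M` is completely virtually regular; (4) the torsion subgroup `T(M)` is
semisimple. -/
theorem fg_abelianGroup_tfae (M : Type*) [AddCommGroup M] (hfg : Module.Finite ℤ M) :
    (VirtuallySemisimple ℤ M ↔ StronglyVirtuallyRegular ℤ M) ∧
    (StronglyVirtuallyRegular ℤ M ↔ CompletelyVirtuallyRegular ℤ M) ∧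
    (CompletelyVirtuallyRegular ℤ M ↔
      IsSemisimpleModule ℤ (Submodule.torsion ℤ M)) := by
  have h12 : VirtuallySemisimple ℤ M ↔ StronglyVirtuallyRegular ℤ M :=
    ⟨fun h => h.stronglyVirtuallyRegular, fun h => h.virtuallySemisimple⟩
  have h14 : VirtuallySemisimple ℤ M ↔ IsSemisimpleModule ℤ (Submodule.torsion ℤ M) :=
    ⟨fun h => h.isSemisimpleModule_torsion, fun _ => .of_isSemisimpleModule_torsion⟩
  have h34 : CompletelyVirtuallyRegular ℤ M ↔ IsSemisimpleModule ℤ (Submodule.torsion ℤ M) :=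
    ⟨fun h => h.isSemisimpleModule_torsion, fun _ => .of_isSemisimpleModule_torsion⟩
  exact ⟨h12, h12.symm.trans (h14.trans h34.symm), h34⟩
end
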